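/- arXiv:cs/0207091 — 6 statements merged into one kernel-verified Lean document; each statement's English description precedes it below -/
import Mathlib

section
/- Let F be a formula of L in prefix negation form whose negation prefix has even length (i.e., F = ¬ⁿG with n even and G negation-free). Then for every N⁴ interpretation I of L and every variable assignment V with respect to I, val_{I,V}(F) ≠ val_{I,V}(¬F). -/
open FirstOrder FirstOrder.Language

attribute [local instance] Classical.propDecidable

universe u v w x

/-- Formulas of the logic N⁴ over a first-order language `L` with variables from `X`. -/
inductive N4Formula (L : FirstOrder.Language.{u, v}) (X : Type x) : Type (max u v x)
  | falsum : N4Formula L X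
  | atom : {n : ℕ} → L.Relations n → (Fin n → L.Term X) → N4Formula L X
  | neg : N4Formula L X → N4Formula L X
  | conj : N4Formula L X → N4Formula L X → N4Formula L X
  | disj : N4Formula L X → N4Formula L X → N4Formula L X
  | all : X → N4Formula L X → N4Formula L X
  | ex : X → N4Formula L X → N4Formula L X

/-- `n`-fold negation `¬ⁿ F`. -/
def N4Formula.iterNeg {L : FirstOrder.Language} {X : Type*} (n : ℕ) (F : N4Formula L X) : N4Formula L X :=
  N4Formula.neg^[n] F

/-- An N⁴ interpretation: a nonempty domain, interpretations of the function symbols, and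
two Boolean relations for each predicate symbol `p`: one for `p` and one for `¬²p`,
with `val(p) ⊆ val(¬²p)`. -/
structure N4Interp (L : FirstOrder.Language.{u, v}) : Type (max u v (w + 1)) where
  Dom : Type w
  nonempty : Nonempty Dom
  funMap : ∀ {n : ℕ}, L.Functions n → (Fin n → Dom) → Dom
  relMap : ∀ {n : ℕ}, L.Relations n → (Fin n → Dom) → Bool
  relMap2 : ∀ {n : ℕ}, L.Relations n → (Fin n → Dom) → Bool
  mono : ∀ {n : ℕ} (R : L.Relations n) (ds : Fin n → Dom),
    relMap R ds = true → relMap2 R ds = true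

/-- Evaluation of terms in an N⁴ interpretation under a variable assignment. -/
def N4Interp.termVal {L : FirstOrder.Language} (I : N4Interp L) {X : Type*} (ρ : X → I.Dom) :
    L.Term X → I.Dom
  | .var y => ρ y
  | .func f ts => I.funMap f fun i => I.termVal ρ (ts i)

/-- Negation modes: `m0` evaluates `F`, `m1` evaluates `¬F`, `m2` evaluates `¬²F`,
`m3` evaluates `¬³F`.  Since `¬⁴` reduces to `¬²`, the successor of `m3` is `m2`. -/
inductive N4Mode : Type
  | m0 | m1 | m2 | m3

/-- The mode shift performed by one application of negation. -/
def N4Mode.next : N4Mode → N4Mode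
  | .m0 => .m1
  | .m1 => .m2
  | .m2 => .m3
  | .m3 => .m2

/-- The two-valued N⁴ valuation.  `I.val ρ m F` is the truth value of `¬ᵐF` under the
assignment `ρ`, implementing the recursive clauses of the paper: atoms, `∧`, `∨`, `∀`, `∃`
are evaluated classically; single negation of atoms is complementation; negation is pushed
through compound formulas by de Morgan and quantifier dualities; `¬²` of an atom is given
by the second relation; `¬²` commutes with `∧`, `∨`, `∀`, `∃`; and `¬³F` is true iff
`¬²F` is not true. -/
noncomputable def N4Interp.val {L : FirstOrder.Language} (I : N4Interp L) {X : Type*} :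
    (X → I.Dom) → N4Mode → N4Formula L X → Bool
  | _, .m0, .falsum => false
  | _, .m1, .falsum => true
  | _, .m2, .falsum => false
  | _, .m3, .falsum => true
  | ρ, .m0, .atom R ts => I.relMap R fun i => I.termVal ρ (ts i)
  | ρ, .m1, .atom R ts => !(I.relMap R fun i => I.termVal ρ (ts i))
  | ρ, .m2, .atom R ts => I.relMap2 R fun i => I.termVal ρ (ts i)
  | ρ, .m3, .atom R ts => !(I.relMap2 R fun i => I.termVal ρ (ts i))
  | ρ, m, .neg F => I.val ρ m.next F
  | ρ, .m0, .conj F G => I.val ρ .m0 F && I.val ρ .m0 G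
  | ρ, .m1, .conj F G => I.val ρ .m1 F || I.val ρ .m1 G
  | ρ, .m2, .conj F G => I.val ρ .m2 F && I.val ρ .m2 G
  | ρ, .m3, .conj F G => !(I.val ρ .m2 F && I.val ρ .m2 G)
  | ρ, .m0, .disj F G => I.val ρ .m0 F || I.val ρ .m0 G
  | ρ, .m1, .disj F G => I.val ρ .m1 F && I.val ρ .m1 G
  | ρ, .m2, .disj F G => I.val ρ .m2 F || I.val ρ .m2 G
  | ρ, .m3, .disj F G => !(I.val ρ .m2 F || I.val ρ .m2 G)
  | ρ, .m0, .all y F => decide (∀ d : I.Dom, I.val (fun z => if z = y then d else ρ z) .m0 F = true)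
  | ρ, .m1, .all y F => decide (∃ d : I.Dom, I.val (fun z => if z = y then d else ρ z) .m1 F = true)
  | ρ, .m2, .all y F => decide (∀ d : I.Dom, I.val (fun z => if z = y then d else ρ z) .m2 F = true)
  | ρ, .m3, .all y F => !decide (∀ d : I.Dom, I.val (fun z => if z = y then d else ρ z) .m2 F = true)
  | ρ, .m0, .ex y F => decide (∃ d : I.Dom, I.val (fun z => if z = y then d else ρ z) .m0 F = true)
  | ρ, .m1, .ex y F => decide (∀ d : I.Dom, I.val (fun z => if z = y then d else ρ z) .m1 F = true)
  | ρ, .m2, .ex y F => decide (∃ d : I.Dom, I.val (fun z => if z = y then d else ρ z) .m2 F = true)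
  | ρ, .m3, .ex y F => !decide (∃ d : I.Dom, I.val (fun z => if z = y then d else ρ z) .m2 F = true)

/-- A formula is negation-free if no negations occur in it. -/
def N4Formula.NegFree {L : FirstOrder.Language} {X : Type*} : N4Formula L X → Prop
  | .falsum => True
  | .atom _ _ => True
  | .neg _ => False
  | .conj F G => F.NegFree ∧ G.NegFree
  | .disj F G => F.NegFree ∧ G.NegFree
  | .all _ F => F.NegFree
  | .ex _ F => F.NegFree

namespace N4Interp

variable {L : FirstOrder.Language} {X : Type*} (I : N4Interp L)

theorem val_neg (ρ : X → I.Dom) (m : N4Mode) (F : N4Formula L X) :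
    I.val ρ m F.neg = I.val ρ m.next F := by
  cases m <;> simp only [val]

theorem val_iterNeg (ρ : X → I.Dom) (n : ℕ) (m : N4Mode) (F : N4Formula L X) :
    I.val ρ m (F.iterNeg n) = I.val ρ (N4Mode.next^[n] m) F := by
  induction n generalizing m with
  | zero => rfl
  | succ n ih =>
    rw [N4Formula.iterNeg, Function.iterate_succ_apply', val_neg, Function.iterate_succ_apply]
    exact ih m.next

theorem val_m3 (ρ : X → I.Dom) (F : N4Formula L X) : I.val ρ .m3 F = !I.val ρ .m2 F := by
  induction F with
  | neg F ih => simp [val_neg, N4Mode.next, ih]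
  | _ => simp [val]

/-- On negation-free formulas, single negation is Boolean complementation. -/
theorem val_m1_of_negFree (ρ : X → I.Dom) (F : N4Formula L X) (hF : F.NegFree) :
    I.val ρ .m1 F = !I.val ρ .m0 F := by
  induction F generalizing ρ with
  | falsum => simp [val]
  | atom R ts => simp [val]
  | neg F => exact hF.elim
  | conj F G ihF ihG => simp [val, ihF ρ hF.1, ihG ρ hF.2]
  | disj F G ihF ihG => simp [val, ihF ρ hF.1, ihG ρ hF.2]
  | all y F ih =>
    rw [Bool.eq_iff_iff]
    simp [val, ih _ hF]
  | ex y F ih =>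
    rw [Bool.eq_iff_iff]
    simp [val, ih _ hF]

end N4Interp

theorem N4Mode.iterate_next_m0_of_even {n : ℕ} (hn : Even n) :
    N4Mode.next^[n] .m0 = .m0 ∨ N4Mode.next^[n] .m0 = .m2 := by
  obtain ⟨k, rfl⟩ := hn
  rw [← two_mul]
  induction k with
  | zero => exact .inl rfl
  | succ k ih =>
    rw [show 2 * (k + 1) = 2 * k + 1 + 1 by ring, Function.iterate_succ_apply',
      Function.iterate_succ_apply']
    rcases ih with h | h <;> rw [h] <;> exact .inr rfl

/-- Proposition 2: if `F = ¬ⁿG` is in prefix negation form with an even negation prefix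
(`n` even, `G` negation-free), then `F` and `¬F` receive different truth values in every
N⁴ interpretation under every variable assignment. -/
theorem n4_p_not_p {L : FirstOrder.Language} {X : Type*} (I : N4Interp L)
    (ρ : X → I.Dom) (n : ℕ) (hn : Even n) (G : N4Formula L X) (hG : G.NegFree) :
    I.val ρ .m0 (G.iterNeg n) ≠ I.val ρ .m0 (G.iterNeg n).neg := by
  rw [N4Interp.val_neg, N4Interp.val_iterNeg, N4Interp.val_iterNeg,
    ← Function.iterate_succ_apply, Function.iterate_succ_apply']
  rcases N4Mode.iterate_next_m0_of_even hn with h | h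
  · simp [h, N4Mode.next, I.val_m1_of_negFree ρ G hG]
  · simp [h, N4Mode.next, I.val_m3 ρ G]
end

section
/- Laws of excluded middle in N⁴: for every N⁴ interpretation I of L, every variable assignment V with respect to I, and every formula F of L, val_{I,V}(F ∨ ¬F) = true, val_{I,V}(¬F ∨ ¬²F) = true, and val_{I,V}(¬²F ∨ ¬³F) = true. -/
open FirstOrder FirstOrder.Language

attribute [local instance] Classical.propDecidable

universe u v w x

theorem forall_or_exists_of_forall_or {α : Sort*} {p q : α → Prop} (h : ∀ a, p a ∨ q a) :
    (∀ a, p a) ∨ ∃ a, q a :=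
  or_iff_not_imp_right.2 fun hq a => (h a).resolve_right fun ha => hq ⟨a, ha⟩

/-- Consecutive negation modes cover all cases: one of `¬ᵐF`, `¬ᵐ⁺¹F` is always true. -/
theorem N4Interp.val_or_val_next {L : FirstOrder.Language} {X : Type*} (I : N4Interp L)
    (F : N4Formula L X) :
    ∀ (ρ : X → I.Dom) (m : N4Mode), I.val ρ m F = true ∨ I.val ρ m.next F = true := by
  induction F with
  | falsum => intro ρ m; cases m <;> simp [N4Mode.next, N4Interp.val]
  | atom R ts =>
    intro ρ m
    have := I.mono R fun i => I.termVal ρ (ts i)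
    cases m <;> simp only [N4Mode.next, N4Interp.val] <;> grind
  | neg F ih =>
    intro ρ m
    simpa only [N4Interp.val] using ih ρ m.next
  | conj F G ihF ihG | disj F G ihF ihG =>
    intro ρ m
    have hF := ihF ρ m
    have hG := ihG ρ m
    cases m <;> simp only [N4Mode.next, N4Interp.val] at hF hG ⊢ <;> grind
  | all y F ih | ex y F ih =>
    intro ρ m
    have h := fun d => ih (fun z => if z = y then d else ρ z) m
    cases m <;> simp only [N4Mode.next, N4Interp.val, Bool.not_eq_true', decide_eq_true_eq,
      decide_eq_false_iff_not] at h ⊢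
    all_goals first
      | exact em _
      | exact (em _).symm
      | exact forall_or_exists_of_forall_or h
      | exact (forall_or_exists_of_forall_or fun d => (h d).symm).symm

/-- Laws of excluded middle in N⁴: `F ∨ ¬F`, `¬F ∨ ¬²F` and `¬²F ∨ ¬³F` are true in every
N⁴ interpretation under every variable assignment. -/
theorem n4_excluded_middle {L : FirstOrder.Language} {X : Type*} (I : N4Interp L)
    (ρ : X → I.Dom) (F : N4Formula L X) :
    I.val ρ .m0 (F.disj F.neg) = true ∧
    I.val ρ .m0 (F.neg.disj F.neg.neg) = true ∧
    I.val ρ .m0 (F.neg.neg.disj F.neg.neg.neg) = true := by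
  simp only [N4Interp.val, Bool.or_eq_true]
  exact ⟨I.val_or_val_next F ρ .m0, I.val_or_val_next F ρ .m1, I.val_or_val_next F ρ .m2⟩
end

section
/- Let F be a formula of L in prefix negation form whose negation prefix has even length (i.e., F = ¬ⁿG with n even and G negation-free). For every N⁴ interpretation I of L and every variable assignment V with respect to I, if val_{I,V}(F) = true then val_{I,V}(¬²F) = true. -/
open FirstOrder FirstOrder.Language

attribute [local instance] Classical.propDecidable

universe u v w x

/-- Negating a formula shifts the mode of evaluation. -/
theorem N4Interp.val_neg_s6 {L : FirstOrder.Language} (I : N4Interp L) {X : Type*}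
    (ρ : X → I.Dom) (m : N4Mode) (F : N4Formula L X) :
    I.val ρ m F.neg = I.val ρ m.next F := by
  cases m <;> simp only [N4Interp.val]

/-- Iterated negation iterates the shift of the mode of evaluation. -/
theorem N4Interp.val_iterNeg_s6 {L : FirstOrder.Language} (I : N4Interp L) {X : Type*}
    (ρ : X → I.Dom) (n : ℕ) (m : N4Mode) (F : N4Formula L X) :
    I.val ρ m (F.iterNeg n) = I.val ρ (N4Mode.next^[n] m) F := by
  induction n generalizing m with
  | zero => rfl
  | succ n ih =>
    rw [Function.iterate_succ_apply, ← ih, ← I.val_neg_s6, N4Formula.iterNeg,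
      Function.iterate_succ_apply', N4Formula.iterNeg]

/-- The mode `m2` is fixed by every even number of negations. -/
theorem N4Mode.next_iterate_two_mul_m2 (k : ℕ) :
    N4Mode.next^[2 * k] .m2 = .m2 := by
  rw [Function.iterate_mul]
  exact Function.iterate_fixed rfl k

/-- A true negation-free formula has a true double negation. -/
theorem N4Formula.NegFree.val_m2_of_val_m0 {L : FirstOrder.Language} {X : Type*}
    {I : N4Interp L} {G : N4Formula L X} (hG : G.NegFree) {ρ : X → I.Dom}
    (h : I.val ρ .m0 G = true) : I.val ρ .m2 G = true := by
  induction G generalizing ρ with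
  | falsum => simp [N4Interp.val] at h
  | atom R ts =>
    simp only [N4Interp.val] at h ⊢
    exact I.mono _ _ h
  | neg F => exact hG.elim
  | conj F G ihF ihG =>
    simp only [N4Interp.val, Bool.and_eq_true] at h ⊢
    exact ⟨ihF hG.1 h.1, ihG hG.2 h.2⟩
  | disj F G ihF ihG =>
    simp only [N4Interp.val, Bool.or_eq_true] at h ⊢
    exact h.imp (ihF hG.1) (ihG hG.2)
  | all y F ih =>
    simp only [N4Interp.val, decide_eq_true_eq] at h ⊢
    exact fun d => ih hG (h d)
  | ex y F ih =>
    simp only [N4Interp.val, decide_eq_true_eq] at h ⊢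
    exact h.imp fun _ hd => ih hG hd

/-- Proposition 4: if `F = ¬ⁿG` is in prefix negation form with an even negation prefix
(`n` even, `G` negation-free) and `F` is true, then `¬²F` is true. -/
theorem n4_p_implies_not_not_p {L : FirstOrder.Language} {X : Type*} (I : N4Interp L)
    (ρ : X → I.Dom) (n : ℕ) (hn : Even n) (G : N4Formula L X) (hG : G.NegFree)
    (h : I.val ρ .m0 (G.iterNeg n) = true) :
    I.val ρ .m0 (G.iterNeg n).neg.neg = true := by
  rw [I.val_neg_s6, I.val_neg_s6]
  change I.val ρ .m2 _ = true
  obtain ⟨k, rfl⟩ := hn.exists_two_nsmul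
  rw [smul_eq_mul, I.val_iterNeg_s6] at h ⊢
  rw [N4Mode.next_iterate_two_mul_m2]
  cases k with
  | zero => exact hG.val_m2_of_val_m0 h
  | succ k =>
    rw [Nat.mul_succ, Function.iterate_add_apply] at h
    exact N4Mode.next_iterate_two_mul_m2 k ▸ h
end

section
/- For every N⁴ interpretation I of L, the following are equivalent: (1) I induces a classical logic interpretation, i.e., val_I(¬²p) = val_I(p) for every predicate symbol p of L; (2) I is complete, i.e., I is F-complete for every formula F of L; (3) I is A-complete for every atom A of L. -/
open FirstOrder FirstOrder.Language

attribute [local instance] Classical.propDecidable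

universe u v w x

/-- `I ⊨_{N⁴} F`: the formula `F` is true in `I` for some variable assignment. -/
def N4Interp.Models {L : FirstOrder.Language} (I : N4Interp L) {X : Type*}
    (F : N4Formula L X) : Prop :=
  ∃ ρ : X → I.Dom, I.val ρ .m0 F = true

/-- `I` is an N⁴ model of every formula of the set `S`. -/
def N4Interp.ModelsSet {L : FirstOrder.Language} (I : N4Interp L) {X : Type*}
    (S : Set (N4Formula L X)) : Prop :=
  ∀ F ∈ S, I.Models F

/-- `S ⊨_{N⁴} F`: every N⁴ model of `S` is an N⁴ model of `F`. -/
def N4Conseq {L : FirstOrder.Language.{u, v}} {X : Type x}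
    (S : Set (N4Formula L X)) (F : N4Formula L X) : Prop :=
  ∀ I : N4Interp.{u, v, w} L, I.ModelsSet S → I.Models F

/-- `I` is `F`-complete: `F` and `¬²F` get the same truth value under every assignment. -/
def N4Interp.FComplete {L : FirstOrder.Language} (I : N4Interp L) {X : Type*}
    (F : N4Formula L X) : Prop :=
  ∀ ρ : X → I.Dom, I.val ρ .m0 F = I.val ρ .m0 F.neg.neg

/-- `I` is complete: it is `F`-complete for every formula `F`. -/
def N4Interp.Complete {L : FirstOrder.Language} (I : N4Interp L) (X : Type*) : Prop :=
  ∀ F : N4Formula L X, I.FComplete F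

/-- A classical first-order interpretation of `L`. -/
structure ClassInterp (L : FirstOrder.Language.{u, v}) : Type (max u v (w + 1)) where
  Dom : Type w
  nonempty : Nonempty Dom
  funMap : ∀ {n : ℕ}, L.Functions n → (Fin n → Dom) → Dom
  relMap : ∀ {n : ℕ}, L.Relations n → (Fin n → Dom) → Bool

/-- Evaluation of terms in a classical interpretation. -/
def ClassInterp.termVal {L : FirstOrder.Language} (J : ClassInterp L) {X : Type*}
    (ρ : X → J.Dom) : L.Term X → J.Dom
  | .var y => ρ y
  | .func f ts => J.funMap f fun i => J.termVal ρ (ts i)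

/-- The usual classical (two-valued, double-negation-eliminating) valuation of formulas. -/
noncomputable def ClassInterp.cval {L : FirstOrder.Language} (J : ClassInterp L) {X : Type*} :
    (X → J.Dom) → N4Formula L X → Bool
  | _, .falsum => false
  | ρ, .atom R ts => J.relMap R fun i => J.termVal ρ (ts i)
  | ρ, .neg F => !(J.cval ρ F)
  | ρ, .conj F G => J.cval ρ F && J.cval ρ G
  | ρ, .disj F G => J.cval ρ F || J.cval ρ G
  | ρ, .all y F => decide (∀ d : J.Dom, J.cval (fun z => if z = y then d else ρ z) F = true)
  | ρ, .ex y F => decide (∃ d : J.Dom, J.cval (fun z => if z = y then d else ρ z) F = true)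

/-- The N⁴ interpretation induced by a classical interpretation: `¬²p` is interpreted
exactly as `p`. -/
noncomputable def ClassInterp.toN4 {L : FirstOrder.Language} (J : ClassInterp L) :
    N4Interp L where
  Dom := J.Dom
  nonempty := J.nonempty
  funMap := J.funMap
  relMap := J.relMap
  relMap2 := J.relMap
  mono _ _ h := h

/-- Atoms of `L` with variables from `X` (a relation symbol applied to terms). -/
abbrev VarAtom (L : FirstOrder.Language) (X : Type*) :=
  Σ n : ℕ, L.Relations n × (Fin n → L.Term X)

/-- The atomic formula corresponding to an atom. -/
def VarAtom.toFormula {L : FirstOrder.Language} {X : Type*} (a : VarAtom L X) :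
    N4Formula L X :=
  N4Formula.atom a.2.1 a.2.2

/-- Ground atoms of `L` (atoms without variables). -/
abbrev GroundAtom (L : FirstOrder.Language) := Σ n : ℕ, L.Relations n × (Fin n → L.Term Empty)

/-- A ground atom as an atom with variables from `X`. -/
def GroundAtom.toVar {L : FirstOrder.Language} (X : Type*) (a : GroundAtom L) : VarAtom L X :=
  ⟨a.1, (a.2.1, fun i => (a.2.2 i).relabel Empty.elim)⟩

/-- A ground atom as a formula. -/
def GroundAtom.toFormula {L : FirstOrder.Language} (X : Type*) (a : GroundAtom L) :
    N4Formula L X :=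
  (a.toVar X).toFormula

/-- The N⁴ Herbrand base: positive ground N⁴ literals, i.e. ground atoms (`Sum.inl`)
and doubly negated ground atoms (`Sum.inr`). -/
abbrev N4HerbrandBase (L : FirstOrder.Language) := GroundAtom L ⊕ GroundAtom L

/-- The formula corresponding to a positive ground N⁴ literal. -/
def N4Lit.toFormula {L : FirstOrder.Language} (X : Type*) :
    N4HerbrandBase L → N4Formula L X
  | .inl a => a.toFormula X
  | .inr a => (a.toFormula X).neg.neg

/-- `M ⊆ B²_L` is closed if it contains `¬²A` whenever it contains `A`. -/
def N4Closed {L : FirstOrder.Language} (M : Set (N4HerbrandBase L)) : Prop :=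
  ∀ a : GroundAtom L, Sum.inl a ∈ M → Sum.inr a ∈ M

/-- `M̃`: the negations of the positive ground N⁴ literals not in `M`. -/
def tildeSet {L : FirstOrder.Language} (X : Type*) (M : Set (N4HerbrandBase L)) :
    Set (N4Formula L X) :=
  (fun l => (N4Lit.toFormula X l).neg) '' Mᶜ

instance {L : FirstOrder.Language} [h : Nonempty L.Constants] : Nonempty (L.Term Empty) :=
  h.elim fun c => ⟨c.term⟩

/-- An N⁴ Herbrand interpretation of `L`: the domain is the Herbrand universe
(the ground terms), constants and function symbols are interpreted syntactically, so the
interpretation is determined by the two relations interpreting each `p` and `¬²p`. -/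
structure HerbInterp (L : FirstOrder.Language) where
  relMap : ∀ {n : ℕ}, L.Relations n → (Fin n → L.Term Empty) → Bool
  relMap2 : ∀ {n : ℕ}, L.Relations n → (Fin n → L.Term Empty) → Bool
  mono : ∀ {n : ℕ} (R : L.Relations n) (ts : Fin n → L.Term Empty),
    relMap R ts = true → relMap2 R ts = true

/-- The N⁴ interpretation corresponding to an N⁴ Herbrand interpretation. -/
noncomputable def HerbInterp.toN4 {L : FirstOrder.Language} [Nonempty (L.Term Empty)]
    (H : HerbInterp L) : N4Interp L where
  Dom := L.Term Empty
  nonempty := inferInstance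
  funMap := fun f ts => FirstOrder.Language.Term.func f ts
  relMap := H.relMap
  relMap2 := H.relMap2
  mono := H.mono

/-- `H²(M)`: the N⁴ Herbrand interpretation satisfying exactly the positive ground
N⁴ literals in the closed set `M`. -/
noncomputable def H2 {L : FirstOrder.Language} (M : Set (N4HerbrandBase L))
    (hM : N4Closed M) : HerbInterp L where
  relMap := fun {n} R ts => decide ((Sum.inl ⟨n, (R, ts)⟩ : N4HerbrandBase L) ∈ M)
  relMap2 := fun {n} R ts => decide ((Sum.inr ⟨n, (R, ts)⟩ : N4HerbrandBase L) ∈ M)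
  mono := fun {n} R ts h => decide_eq_true (hM ⟨n, (R, ts)⟩ (of_decide_eq_true h))

/-- The intersection of a family of N⁴ Herbrand interpretations: each relation is
interpreted by the intersection of its interpretations in the members of the family. -/
noncomputable def HerbInterp.inter {L : FirstOrder.Language} {C : Type*}
    (Js : C → HerbInterp L) : HerbInterp L where
  relMap := fun {n} R ts => decide (∀ k : C, (Js k).relMap R ts = true)
  relMap2 := fun {n} R ts => decide (∀ k : C, (Js k).relMap2 R ts = true)
  mono := fun {n} R ts h =>
    decide_eq_true fun k => (Js k).mono R ts (of_decide_eq_true h k)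

/-- A general program clause `A ← B₁, …, Bₙ`: a head atom and a list of body literals;
the Boolean flag is `true` for a positive body atom `B` and `false` for a negated
body atom `¬B`. -/
structure GenClause (L : FirstOrder.Language) (X : Type*) where
  head : VarAtom L X
  body : List (VarAtom L X × Bool)

/-- A positive program clause has no negative body literals. -/
def GenClause.IsPositive {L : FirstOrder.Language} {X : Type*} (C : GenClause L X) : Prop :=
  ∀ b ∈ C.body, b.2 = true

/-- The disjunct contributed by a body literal to the N⁴ clause: `¬B` for a positive
body atom `B`, and `¬²B` (double negation NOT eliminated) for a negative body literal `¬B`. -/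
def bodyLitFm {L : FirstOrder.Language} {X : Type*} (b : VarAtom L X × Bool) :
    N4Formula L X :=
  if b.2 then (b.1.toFormula).neg else (b.1.toFormula).neg.neg

/-- The matrix `(…(A ∨ ¬B₁) ∨ …) ∨ ¬Bₙ` of the N⁴ clause associated with a general
program clause. -/
def GenClause.toFormula {L : FirstOrder.Language} {X : Type*} (C : GenClause L X) :
    N4Formula L X :=
  C.body.foldl (fun acc b => acc.disj (bodyLitFm b)) C.head.toFormula

/-- `I` satisfies a general program clause: the associated universally closed N⁴ clause is
true in `I`, i.e. its matrix is true under every variable assignment. -/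
def N4Interp.SatClause {L : FirstOrder.Language} (I : N4Interp L) {X : Type*}
    (C : GenClause L X) : Prop :=
  ∀ ρ : X → I.Dom, I.val ρ .m0 C.toFormula = true

/-- `I` satisfies (is an N⁴ model of) a logic program: it satisfies all its clauses. -/
def N4Interp.SatProg {L : FirstOrder.Language} (I : N4Interp L) {X : Type*}
    (P : Set (GenClause L X)) : Prop :=
  ∀ C ∈ P, I.SatClause C

/-- A ground general program clause. -/
structure GroundClause (L : FirstOrder.Language) where
  head : GroundAtom L
  body : List (GroundAtom L × Bool)

/-- A ground clause as a general program clause with variables from `X`. -/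
def GroundClause.toGen {L : FirstOrder.Language} (X : Type*) (C : GroundClause L) :
    GenClause L X :=
  ⟨C.head.toVar X, C.body.map fun b => (b.1.toVar X, b.2)⟩

/-- The N⁴ formula associated with a ground clause. -/
def GroundClause.toFormula {L : FirstOrder.Language} (X : Type*) (C : GroundClause L) :
    N4Formula L X :=
  (C.toGen X).toFormula

/-- A classical interpretation satisfies a ground clause if the associated formula is
classically true under every assignment. -/
def ClassInterp.SatGroundClause {L : FirstOrder.Language} (J : ClassInterp L) (X : Type*)
    (C : GroundClause L) : Prop :=
  ∀ ρ : X → J.Dom, J.cval ρ (C.toFormula X) = true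

/-- Classical logical consequence: every classical interpretation satisfying all the
ground clauses of `S` satisfies the ground atom `A`. -/
def ClassConseq {L : FirstOrder.Language.{u, v}} (X : Type x)
    (S : Set (GroundClause L)) (A : GroundAtom L) : Prop :=
  ∀ J : ClassInterp.{u, v, w} L, (∀ C ∈ S, J.SatGroundClause X C) →
    ∀ ρ : X → J.Dom, J.cval ρ (A.toFormula X) = true

/-- `Simp_N(S)`: delete the clauses whose body contains a negative literal `¬A` with
`A ∈ N`, then delete the negative body literals of the remaining clauses. -/
def Simp {L : FirstOrder.Language} (N : Set (GroundAtom L)) (S : Set (GroundClause L)) :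
    Set (GroundClause L) :=
  { C' | ∃ C ∈ S, (∀ b ∈ C.body, b.2 = false → b.1 ∉ N) ∧
      C' = ⟨C.head, C.body.filter fun b => b.2⟩ }

/-- Application of a ground substitution to an atom. -/
def VarAtom.subst {L : FirstOrder.Language} {X : Type*} (a : VarAtom L X)
    (σ : X → L.Term Empty) : GroundAtom L :=
  ⟨a.1, (a.2.1, fun i => (a.2.2 i).subst σ)⟩

/-- A ground instance of a general program clause. -/
def GenClause.inst {L : FirstOrder.Language} {X : Type*} (C : GenClause L X)
    (σ : X → L.Term Empty) : GroundClause L :=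
  ⟨C.head.subst σ, C.body.map fun b => (b.1.subst σ, b.2)⟩

/-- `Ground(P)`: the set of ground instances of the clauses of `P`. -/
def GroundInsts {L : FirstOrder.Language} {X : Type*} (P : Set (GenClause L X)) :
    Set (GroundClause L) :=
  { gc | ∃ C ∈ P, ∃ σ : X → L.Term Empty, gc = C.inst σ }

/-- `H_L(N)` is a stable model of `P` (Gelfond–Lifschitz): for every ground atom `A`,
`A ∈ N` iff `A` is a classical consequence of `Simp_N(Ground(P))`. -/
def IsStable {L : FirstOrder.Language.{u, v}} {X : Type x} (P : Set (GenClause L X))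
    (N : Set (GroundAtom L)) : Prop :=
  ∀ A : GroundAtom L, A ∈ N ↔ ClassConseq.{u, v, w, x} X (Simp N (GroundInsts P)) A

/-- `H²(M)` is a minimal N⁴ Herbrand model of the set `S` of formulas. -/
def IsMinHerbModelSet {L : FirstOrder.Language} [Nonempty (L.Term Empty)] {X : Type*}
    (S : Set (N4Formula L X)) (M : Set (N4HerbrandBase L)) (hM : N4Closed M) : Prop :=
  (H2 M hM).toN4.ModelsSet S ∧
    ∀ (B : Set (N4HerbrandBase L)) (hB : N4Closed B), B ⊆ M → B ≠ M →
      ¬ (H2 B hB).toN4.ModelsSet S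

/-- `H²(M)` is a minimal N⁴ Herbrand model of the logic program `P`. -/
def IsMinHerbModelProg {L : FirstOrder.Language} [Nonempty (L.Term Empty)] {X : Type*}
    (P : Set (GenClause L X)) (M : Set (N4HerbrandBase L)) (hM : N4Closed M) : Prop :=
  (H2 M hM).toN4.SatProg P ∧
    ∀ (B : Set (N4HerbrandBase L)) (hB : N4Closed B), B ⊆ M → B ≠ M →
      ¬ (H2 B hB).toN4.SatProg P

/-- The classical Herbrand interpretation `H_L(N)` satisfying exactly the ground atoms
in `N`. -/
noncomputable def HL {L : FirstOrder.Language} [Nonempty (L.Term Empty)]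
    (N : Set (GroundAtom L)) : ClassInterp L where
  Dom := L.Term Empty
  nonempty := inferInstance
  funMap := fun f ts => FirstOrder.Language.Term.func f ts
  relMap := fun {n} R ts => decide ((⟨n, (R, ts)⟩ : GroundAtom L) ∈ N)

/-- The closed subset of the N⁴ Herbrand base induced by a set `N` of ground atoms:
the atoms of `N` together with their double negations. -/
def doubled {L : FirstOrder.Language} (N : Set (GroundAtom L)) : Set (N4HerbrandBase L) :=
  (Sum.inl '' N) ∪ (Sum.inr '' N)

lemma doubled_closed {L : FirstOrder.Language} (N : Set (GroundAtom L)) :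
    N4Closed (doubled N) := by
  rintro a (⟨b, hb, hba⟩ | ⟨b, hb, hba⟩)
  · exact Or.inr ⟨b, hb, congrArg Sum.inr (Sum.inl.inj hba)⟩
  · exact absurd hba (by simp)

/-- If `¬²p` is interpreted as `p` for every predicate symbol `p`, negation is Boolean complement. -/
theorem N4Interp.val_modes_of_relMap2_eq {L : FirstOrder.Language} {X : Type*} (I : N4Interp L)
    (h : ∀ (n : ℕ) (R : L.Relations n) (ds : Fin n → I.Dom), I.relMap2 R ds = I.relMap R ds)
    (F : N4Formula L X) (ρ : X → I.Dom) :
    I.val ρ .m1 F = !I.val ρ .m0 F ∧ I.val ρ .m2 F = I.val ρ .m0 F ∧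
      I.val ρ .m3 F = !I.val ρ .m0 F := by
  induction F generalizing ρ with
  | falsum => simp [N4Interp.val]
  | atom R ts => simp [N4Interp.val, h]
  | neg F ih => simp [N4Interp.val, N4Mode.next, ih ρ]
  | conj F G ihF ihG => simp [N4Interp.val, ihF ρ, ihG ρ]
  | disj F G ihF ihG => simp [N4Interp.val, ihF ρ, ihG ρ]
  | all y F ih =>
    simp [N4Interp.val, fun ρ => (ih ρ).1, fun ρ => (ih ρ).2.1]
    rw [Bool.eq_iff_iff]
    simp
  | ex y F ih =>
    simp [N4Interp.val, fun ρ => (ih ρ).1, fun ρ => (ih ρ).2.1]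
    rw [Bool.eq_iff_iff]
    simp

/-- Completeness for all atoms forces `¬²p` to be interpreted as `p`: evaluate `p` at distinct
variables. -/
theorem N4Interp.relMap2_eq_of_atom_complete {L : FirstOrder.Language} {X : Type*} [Infinite X]
    (I : N4Interp L) (h : ∀ A : VarAtom L X, I.FComplete A.toFormula)
    (n : ℕ) (R : L.Relations n) (ds : Fin n → I.Dom) : I.relMap2 R ds = I.relMap R ds := by
  have := I.nonempty
  let e : Fin n ↪ X := Fin.valEmbedding.trans (Infinite.natEmbedding X)
  obtain ⟨ρ, hρ⟩ : ∃ ρ : X → I.Dom, ∀ i, ρ (e i) = ds i :=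
    ⟨Function.extend e ds fun _ => Classical.arbitrary _, e.injective.extend_apply ds _⟩
  have hA := h ⟨n, R, fun i => .var (e i)⟩ ρ
  simpa [VarAtom.toFormula, N4Interp.val, N4Mode.next, N4Interp.termVal, hρ] using hA.symm

/-- Proposition 5: for an N⁴ interpretation `I` the following are equivalent:
(1) `I` induces a classical logic interpretation, i.e. `val_I(¬²p) = val_I(p)` for every
predicate symbol `p`; (2) `I` is complete (i.e. `F`-complete for every formula `F`);
(3) `I` is `A`-complete for every atom `A`. -/
theorem n4_complete_equivalents {L : FirstOrder.Language} {X : Type*} [Infinite X]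
    (I : N4Interp L) :
    ((∀ (n : ℕ) (R : L.Relations n) (ds : Fin n → I.Dom), I.relMap2 R ds = I.relMap R ds) ↔
      I.Complete X) ∧
    (I.Complete X ↔ ∀ A : VarAtom L X, I.FComplete A.toFormula) := by
  have complete_of_eq : (∀ (n : ℕ) (R : L.Relations n) (ds : Fin n → I.Dom),
      I.relMap2 R ds = I.relMap R ds) → I.Complete X := fun h F ρ => by
    simpa [N4Interp.val, N4Mode.next] using (I.val_modes_of_relMap2_eq h F ρ).2.1.symm
  exact ⟨⟨complete_of_eq, fun h => I.relMap2_eq_of_atom_complete fun A => h A.toFormula⟩,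
    fun h A => h A.toFormula, fun h => complete_of_eq (I.relMap2_eq_of_atom_complete h)⟩
end

section
/- The classical minimal Herbrand model of a positive logic program coincides with its unique minimal N⁴ Herbrand model: if P is a positive logic program (a finite set of clauses A ← B₁,…,Bₙ with A, B₁,…,Bₙ atoms) with least classical Herbrand model H_L(N), then H²(N ∪ {¬²A | A ∈ N}) is the unique minimal N⁴ Herbrand model of P. -/
open FirstOrder FirstOrder.Language

attribute [local instance] Classical.propDecidable

universe u v w x

/-- The ground atoms contained in a subset of the N⁴ Herbrand base. -/
def groundAtomsOf {L : FirstOrder.Language} (M : Set (N4HerbrandBase L)) :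
    Set (GroundAtom L) :=
  Sum.inl ⁻¹' M

lemma groundAtomsOf_doubled {L : FirstOrder.Language} (N : Set (GroundAtom L)) :
    groundAtomsOf (doubled N) = N := by
  ext a
  simp [groundAtomsOf, doubled]

lemma doubled_subset_iff {L : FirstOrder.Language} {N : Set (GroundAtom L)}
    {M : Set (N4HerbrandBase L)} (hM : N4Closed M) :
    doubled N ⊆ M ↔ N ⊆ groundAtomsOf M := by
  constructor
  · exact fun h a ha => h (Or.inl ⟨a, ha, rfl⟩)
  · rintro h _ (⟨a, ha, rfl⟩ | ⟨a, ha, rfl⟩)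
    · exact h ha
    · exact hM a (h ha)

lemma H2_termVal_eq_HL {L : FirstOrder.Language} [Nonempty (L.Term Empty)] {X : Type*}
    (M : Set (N4HerbrandBase L)) (hM : N4Closed M) (N : Set (GroundAtom L))
    (ρ : X → L.Term Empty) (t : L.Term X) :
    (H2 M hM).toN4.termVal ρ t = (HL N).termVal ρ t := by
  induction t with
  | var y => rfl
  | func f ts ih => exact congrArg (Term.func f) (funext ih)

lemma H2_relMap_eq_HL {L : FirstOrder.Language} [Nonempty (L.Term Empty)] {X : Type*}
    (M : Set (N4HerbrandBase L)) (hM : N4Closed M) (ρ : X → L.Term Empty)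
    (a : VarAtom L X) :
    ((H2 M hM).toN4.relMap a.2.1 fun i => (H2 M hM).toN4.termVal ρ (a.2.2 i)) =
      (HL (groundAtomsOf M)).relMap a.2.1
        fun i => (HL (groundAtomsOf M)).termVal ρ (a.2.2 i) :=
  congrArg ((H2 M hM).toN4.relMap a.2.1)
    (funext fun i => H2_termVal_eq_HL M hM (groundAtomsOf M) ρ (a.2.2 i))

/-- On the matrix of a positive clause, `H²(M)` agrees with the classical Herbrand
interpretation given by the atoms of `M`. -/
lemma H2_val_eq_HL_cval {L : FirstOrder.Language} [Nonempty (L.Term Empty)] {X : Type*}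
    (M : Set (N4HerbrandBase L)) (hM : N4Closed M) {C : GenClause L X}
    (hC : C.IsPositive) (ρ : X → L.Term Empty) :
    (H2 M hM).toN4.val ρ .m0 C.toFormula = (HL (groundAtomsOf M)).cval ρ C.toFormula := by
  have foldl_agree : ∀ (l : List (VarAtom L X × Bool)), (∀ b ∈ l, b.2 = true) →
      ∀ F : N4Formula L X,
        (H2 M hM).toN4.val ρ .m0 F = (HL (groundAtomsOf M)).cval ρ F →
        (H2 M hM).toN4.val ρ .m0 (l.foldl (fun acc b => acc.disj (bodyLitFm b)) F) =
          (HL (groundAtomsOf M)).cval ρ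
            (l.foldl (fun acc b => acc.disj (bodyLitFm b)) F) := by
    intro l
    induction l with
    | nil => exact fun _ _ h => h
    | cons b l ih =>
      intro hl F hF
      refine ih (fun c hc => hl c (List.mem_cons_of_mem b hc)) _ ?_
      have hb : b.2 = true := hl b List.mem_cons_self
      simp only [bodyLitFm, hb, if_true, VarAtom.toFormula, N4Interp.val, N4Mode.next,
        ClassInterp.cval]
      exact congrArg₂ (fun p q => p || !q) hF (H2_relMap_eq_HL M hM ρ b.1)
  refine foldl_agree C.body hC _ ?_
  simp only [VarAtom.toFormula, N4Interp.val, ClassInterp.cval]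
  exact H2_relMap_eq_HL M hM ρ C.head

lemma H2_satProg_iff_HL {L : FirstOrder.Language} [Nonempty (L.Term Empty)] {X : Type*}
    {P : Set (GenClause L X)} (hpos : ∀ C ∈ P, C.IsPositive)
    (M : Set (N4HerbrandBase L)) (hM : N4Closed M) :
    (H2 M hM).toN4.SatProg P ↔
      ∀ C ∈ P, ∀ ρ : X → (HL (groundAtomsOf M)).Dom,
        (HL (groundAtomsOf M)).cval ρ C.toFormula = true :=
  forall₂_congr fun C hC => forall_congr' fun ρ => by
    rw [H2_val_eq_HL_cval M hM (hpos C hC) ρ]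

/-- The classical minimal Herbrand model of a positive logic program coincides with its
unique minimal N⁴ Herbrand model: if `P` is a positive logic program with least classical
Herbrand model `H_L(N)`, then `H²(N ∪ {¬²A | A ∈ N})` is the unique minimal N⁴ Herbrand
model of `P`. -/
theorem positive_program_unique_minimal_model {L : FirstOrder.Language}
    [Nonempty L.Constants] {X : Type*} (P : Set (GenClause L X)) (hP : P.Finite)
    (hpos : ∀ C ∈ P, C.IsPositive) (N : Set (GroundAtom L))
    (hmodel : ∀ C ∈ P, ∀ ρ : X → (HL N).Dom, (HL N).cval ρ C.toFormula = true)
    (hleast : ∀ N' : Set (GroundAtom L),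
      (∀ C ∈ P, ∀ ρ : X → (HL N').Dom, (HL N').cval ρ C.toFormula = true) → N ⊆ N') :
    IsMinHerbModelProg P (doubled N) (doubled_closed N) ∧
    ∀ (M : Set (N4HerbrandBase L)) (hM : N4Closed M),
      IsMinHerbModelProg P M hM → M = doubled N := by
  have hsat : (H2 (doubled N) (doubled_closed N)).toN4.SatProg P := by
    rw [H2_satProg_iff_HL hpos, groundAtomsOf_doubled]
    exact hmodel
  have hsub : ∀ (B : Set (N4HerbrandBase L)) (hB : N4Closed B),
      (H2 B hB).toN4.SatProg P → doubled N ⊆ B := fun B hB h =>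
    (doubled_subset_iff hB).2 (hleast _ ((H2_satProg_iff_HL hpos B hB).1 h))
  refine ⟨⟨hsat, fun B hB hBN hne h => hne (hBN.antisymm (hsub B hB h))⟩, ?_⟩
  intro M hM hmin
  by_contra hne
  exact hmin.2 (doubled N) (doubled_closed N) (hsub M hM hmin.1) (Ne.symm hne) hsat
end

section
/- In the propositional language whose only predicate symbols are the 0-ary symbols a and b, the normal logic program P₂ = {a ← ¬b, b ← ¬a} (whose associated N⁴ clauses are a ∨ ¬²b and b ∨ ¬²a) has exactly three minimal N⁴ Herbrand models: H²({a, ¬²a}), H²({¬²a, ¬²b}), and H²({b, ¬²b}); the model H²({¬²a, ¬²b}) is incomplete. -/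
open FirstOrder FirstOrder.Language

attribute [local instance] Classical.propDecidable

universe u v w x

/-- A language whose only predicate symbols are the 0-ary symbols `a` (encoded `true`)
and `b` (encoded `false`); one constant is included so that the Herbrand universe is
nonempty. -/
def PLangAB : FirstOrder.Language :=
  ⟨fun n => match n with | 0 => Unit | _ + 1 => Empty,
   fun n => match n with | 0 => Bool | _ + 1 => Empty⟩

instance : Nonempty PLangAB.Constants := ⟨()⟩

/-- The ground atom `a`. -/
def aGA : GroundAtom PLangAB := ⟨0, (true, fun i => i.elim0)⟩

/-- The ground atom `b`. -/
def bGA : GroundAtom PLangAB := ⟨0, (false, fun i => i.elim0)⟩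

/-- The atom `a` (with variables from `ℕ`). -/
def aVA : VarAtom PLangAB ℕ := ⟨0, (true, fun i => i.elim0)⟩

/-- The atom `b` (with variables from `ℕ`). -/
def bVA : VarAtom PLangAB ℕ := ⟨0, (false, fun i => i.elim0)⟩

/-- The program `P₂ = {a ← ¬b, b ← ¬a}`. -/
def P2 : Set (GenClause PLangAB ℕ) := {⟨aVA, [(bVA, false)]⟩, ⟨bVA, [(aVA, false)]⟩}

/-- The closed set `{a, ¬²a}`. -/
def Ma : Set (N4HerbrandBase PLangAB) := {Sum.inl aGA, Sum.inr aGA}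

/-- The closed set `{¬²a, ¬²b}`. -/
def Mab : Set (N4HerbrandBase PLangAB) := {Sum.inr aGA, Sum.inr bGA}

/-- The closed set `{b, ¬²b}`. -/
def Mb : Set (N4HerbrandBase PLangAB) := {Sum.inl bGA, Sum.inr bGA}

lemma Mab_closed : N4Closed Mab := by
  intro x hx
  simp only [Mab, Set.mem_insert_iff, Set.mem_singleton_iff] at hx
  rcases hx with h | h <;> cases h

lemma groundAtom_eq_aGA_or_bGA (q : GroundAtom PLangAB) : q = aGA ∨ q = bGA := by
  obtain ⟨n, R, ts⟩ := q
  cases n with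
  | zero =>
    obtain rfl : ts = fun i => i.elim0 := funext fun i => i.elim0
    cases (R : Bool)
    · exact Or.inr rfl
    · exact Or.inl rfl
  | succ n => exact Empty.elim R

lemma aGA_ne_bGA : aGA ≠ bGA := fun h =>
  Bool.noConfusion (show true = false from
    congrArg (fun q : GroundAtom PLangAB =>
      match q with
      | ⟨0, (R, _)⟩ => (R : Bool)
      | ⟨_ + 1, _⟩ => true) h)

lemma H2_toN4_val_aVA {M : Set (N4HerbrandBase PLangAB)} (hM : N4Closed M)
    (ρ : ℕ → (H2 M hM).toN4.Dom) :
    ((H2 M hM).toN4.val ρ .m0 aVA.toFormula = true ↔ Sum.inl aGA ∈ M) ∧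
    ((H2 M hM).toN4.val ρ .m2 aVA.toFormula = true ↔ Sum.inr aGA ∈ M) := by
  have h : (fun i => (H2 M hM).toN4.termVal ρ (aVA.2.2 i)) = fun i : Fin 0 => i.elim0 :=
    funext fun i => i.elim0
  constructor <;> rw [VarAtom.toFormula, N4Interp.val, h] <;> exact decide_eq_true_iff

lemma H2_toN4_val_bVA {M : Set (N4HerbrandBase PLangAB)} (hM : N4Closed M)
    (ρ : ℕ → (H2 M hM).toN4.Dom) :
    ((H2 M hM).toN4.val ρ .m0 bVA.toFormula = true ↔ Sum.inl bGA ∈ M) ∧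
    ((H2 M hM).toN4.val ρ .m2 bVA.toFormula = true ↔ Sum.inr bGA ∈ M) := by
  have h : (fun i => (H2 M hM).toN4.termVal ρ (bVA.2.2 i)) = fun i : Fin 0 => i.elim0 :=
    funext fun i => i.elim0
  constructor <;> rw [VarAtom.toFormula, N4Interp.val, h] <;> exact decide_eq_true_iff

lemma H2_toN4_satProg_P2_iff {M : Set (N4HerbrandBase PLangAB)} (hM : N4Closed M) :
    (H2 M hM).toN4.SatProg P2 ↔
      (Sum.inl aGA ∈ M ∨ Sum.inr bGA ∈ M) ∧ (Sum.inl bGA ∈ M ∨ Sum.inr aGA ∈ M) := by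
  have : Nonempty (ℕ → (H2 M hM).toN4.Dom) := (H2 M hM).toN4.nonempty.map fun d _ => d
  simp [N4Interp.SatProg, P2, N4Interp.SatClause, GenClause.toFormula, bodyLitFm,
    N4Interp.val, N4Mode.next, H2_toN4_val_aVA, H2_toN4_val_bVA]

lemma set_ext_iff_herbrandBase {M N : Set (N4HerbrandBase PLangAB)} :
    M = N ↔ (Sum.inl aGA ∈ M ↔ Sum.inl aGA ∈ N) ∧ (Sum.inr aGA ∈ M ↔ Sum.inr aGA ∈ N) ∧
      (Sum.inl bGA ∈ M ↔ Sum.inl bGA ∈ N) ∧ (Sum.inr bGA ∈ M ↔ Sum.inr bGA ∈ N) := by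
  refine ⟨by rintro rfl; simp, fun ⟨h₁, h₂, h₃, h₄⟩ => Set.ext ?_⟩
  rintro (q | q) <;> rcases groundAtom_eq_aGA_or_bGA q with rfl | rfl <;> assumption

lemma Ma_closed : N4Closed Ma := by
  intro x hx
  simpa [Ma] using hx

lemma Mb_closed : N4Closed Mb := by
  intro x hx
  simpa [Mb] using hx

/-- Example: the program `P₂ = {a ← ¬b, b ← ¬a}` (read in N⁴ as `a ∨ ¬²b` and
`b ∨ ¬²a`) has exactly three minimal N⁴ Herbrand models, `H²({a, ¬²a})`,
`H²({¬²a, ¬²b})` and `H²({b, ¬²b})`, and the model `H²({¬²a, ¬²b})` is incomplete. -/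
theorem even_loop_minimal_models :
    (∀ (M : Set (N4HerbrandBase PLangAB)) (hM : N4Closed M),
      IsMinHerbModelProg P2 M hM ↔ (M = Ma ∨ M = Mab ∨ M = Mb)) ∧
    ¬ (H2 Mab Mab_closed).toN4.Complete ℕ := by
  have hab := aGA_ne_bGA
  have hba := aGA_ne_bGA.symm
  refine ⟨fun M hM => ⟨fun ⟨hsat, hmin⟩ => ?_, fun h => ?_⟩, fun h => ?_⟩
  · rw [H2_toN4_satProg_P2_iff] at hsat
    have hcontains : Ma ⊆ M ∨ Mab ⊆ M ∨ Mb ⊆ M := by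
      have ha := hM aGA
      have hb := hM bGA
      simp only [Ma, Mab, Mb, Set.insert_subset_iff, Set.singleton_subset_iff]
      tauto
    rcases hcontains with h | h | h
    · refine Or.inl (by_contra fun hne => hmin Ma Ma_closed h (Ne.symm hne) ?_)
      simp [H2_toN4_satProg_P2_iff, Ma]
    · refine Or.inr (Or.inl (by_contra fun hne => hmin Mab Mab_closed h (Ne.symm hne) ?_))
      simp [H2_toN4_satProg_P2_iff, Mab]
    · refine Or.inr (Or.inr (by_contra fun hne => hmin Mb Mb_closed h (Ne.symm hne) ?_))
      simp [H2_toN4_satProg_P2_iff, Mb]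
  · refine ⟨?_, fun B hB hBM hne hsat => hne ?_⟩
    · rw [H2_toN4_satProg_P2_iff]
      rcases h with rfl | rfl | rfl <;> simp [Ma, Mab, Mb]
    · rw [H2_toN4_satProg_P2_iff] at hsat
      have ha := hB aGA
      have hb := hB bGA
      have h₁ := @hBM (Sum.inl aGA)
      have h₂ := @hBM (Sum.inr aGA)
      have h₃ := @hBM (Sum.inl bGA)
      have h₄ := @hBM (Sum.inr bGA)
      rw [set_ext_iff_herbrandBase]
      rcases h with rfl | rfl | rfl <;>
        simp [Ma, Mab, Mb, hab, hba] at h₁ h₂ h₃ h₄ ⊢ <;> tauto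
  · obtain ⟨d⟩ := (H2 Mab Mab_closed).toN4.nonempty
    have h' := h aVA.toFormula fun _ => d
    simp only [N4Interp.val, N4Mode.next] at h'
    have hmem := (H2_toN4_val_aVA Mab_closed fun _ => d).1.1
      (h'.trans ((H2_toN4_val_aVA Mab_closed fun _ => d).2.2 (by simp [Mab])))
    simp [Mab] at hmem
end
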